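/- Let f ∈ AC¹, let x ∈ (−1,1) be irrational, and let (n_j) be a strictly increasing sequence of odd positive integers such that n_j (B_{n_j}(f,x) − f(x)) converges in the two-point compactification ℝ ∪ {±∞} to a limit L. Then L is finite and |L| ≤ 2|O(f,x)|/π. -/

import Mathlib

open Filter Set MeasureTheory

noncomputable section

/-- Equally spaced nodes `x_{k,n} = 2k/n - 1`. -/
def node (n k : ℕ) : ℝ := 2 * k / n - 1

/-- `x` is one of the nodes `x_{0,n}, …, x_{n,n}`. -/
def isNode (n : ℕ) (x : ℝ) : Prop := ∃ k ≤ n, x = node n k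

/-- Denominator of Berrut's interpolant. -/
def Dden (n : ℕ) (x : ℝ) : ℝ :=
  ∑ k ∈ Finset.range (n + 1), (-1 : ℝ) ^ k / (x - node n k)

/-- Numerator of Berrut's interpolant. -/
def Nnum (f : ℝ → ℝ) (n : ℕ) (x : ℝ) : ℝ :=
  ∑ k ∈ Finset.range (n + 1), (-1 : ℝ) ^ k * f (node n k) / (x - node n k)

open Classical in
/-- Berrut's barycentric interpolant. -/
def berrut (f : ℝ → ℝ) (n : ℕ) (x : ℝ) : ℝ :=
  if isNode n x then f x else Nnum f n x / Dden n x

/-- The odd bias function `O(f,x)`. -/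
def Ofun (f : ℝ → ℝ) (x : ℝ) : ℝ :=
  (f x - f 1) / (2 * (x - 1)) - (f x - f (-1)) / (2 * (x + 1))

/-- The even bias function `E(f,x)`. -/
def Efun (f : ℝ → ℝ) (x : ℝ) : ℝ :=
  (f 1 - f x) / (2 * (x - 1)) + (f (-1) - f x) / (2 * (x + 1))

/-- `f` is differentiable on `[-1,1]` with absolutely continuous derivative. -/
def AC1 (f : ℝ → ℝ) : Prop :=
  ∃ f' : ℝ → ℝ,
    (∀ x ∈ Set.Icc (-1 : ℝ) 1, HasDerivWithinAt f (f' x) (Set.Icc (-1 : ℝ) 1) x) ∧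
    ∃ g : ℝ → ℝ, IntervalIntegrable g volume (-1) 1 ∧
      ∀ x ∈ Set.Icc (-1 : ℝ) 1, f' x = f' (-1) + ∫ t in (-1 : ℝ)..x, g t

/-- `x` is regular for the sequence `n j`: eventually never a node. -/
def Regular (n : ℕ → ℕ) (x : ℝ) : Prop := ∃ j₀, ∀ j ≥ j₀, ¬ isNode (n j) x

/-- The function `A(x) = Σ (-1)^k (4k+2)/((2k+1)^2 - x)`. -/
def Afun (x : ℝ) : ℝ := ∑' k : ℕ, (-1 : ℝ) ^ k * (4 * k + 2) / ((2 * k + 1) ^ 2 - x)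

/-- `ι_n(x) = ⌊n(x+1)/2⌋`. -/
def iota (n : ℕ) (x : ℝ) : ℤ := ⌊(n : ℝ) * (x + 1) / 2⌋

/-- `ρ_n(x) = n(x - x_{ι_n(x),n}) - 1 = n(x+1) - 2 ι_n(x) - 1`. -/
def rho (n : ℕ) (x : ℝ) : ℝ := (n : ℝ) * (x + 1) - 2 * (iota n x : ℝ) - 1

open Classical in
/-- The de-biased numerator `Δ_n(f,x)`. -/
def Delta (f : ℝ → ℝ) (n : ℕ) (x : ℝ) : ℝ :=
  if isNode n x then 0 else
    (f (-1) - f x) / (2 * (x + 1)) + (-1 : ℝ) ^ n * (f 1 - f x) / (2 * (x - 1)) +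
      (1 / (n : ℝ)) * ∑ k ∈ Finset.Ioo 0 n, (-1 : ℝ) ^ k * (f (node n k) - f x) / (x - node n k)

end

lemma alt_bd (K : ℕ) : ∀ a : ℕ → ℝ, Antitone a → (∀ m, 0 ≤ a m) →
    0 ≤ ∑ m ∈ Finset.range K, (-1 : ℝ) ^ m * a m ∧
      ∑ m ∈ Finset.range K, (-1 : ℝ) ^ m * a m ≤ a 0 := by
  induction K with
  | zero => intro a _ h; simpa using h 0
  | succ K ih =>
    intro a ha h
    have := ih (fun m => a (m + 1)) (fun i j hij => ha (by omega)) (fun m => h _)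
    have h01 : a 1 ≤ a 0 := ha (by omega)
    rw [Finset.sum_range_succ']
    have e : ∑ k ∈ Finset.range K, (-1 : ℝ) ^ (k + 1) * a (k + 1)
        = - ∑ k ∈ Finset.range K, (-1 : ℝ) ^ k * a (k + 1) := by
      rw [← Finset.sum_neg_distrib]
      exact Finset.sum_congr rfl (fun k _ => by ring)
    rw [e]
    simp only [zero_add] at this
    constructor <;> simp <;> linarith [this.1, this.2]

noncomputable def AA (r : ℝ) (K : ℕ) : ℝ := ∑ m ∈ Finset.range K, (-1 : ℝ) ^ m * (1 / (m + r))

lemma AA_ge (r : ℝ) (hr : 0 < r) (M K : ℕ) (hM : 1 ≤ M) (hK : M ≤ K) :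
    AA r M - 1 / M ≤ AA r K := by
  obtain ⟨j, rfl⟩ := Nat.exists_eq_add_of_le hK
  unfold AA
  rw [Finset.sum_range_add]
  have h := alt_bd j (fun m => 1 / (((M + m : ℕ) : ℝ) + r))
    (fun i j hij => by
      apply one_div_le_one_div_of_le
      · positivity
      · have : ((M + i : ℕ) : ℝ) ≤ ((M + j : ℕ) : ℝ) := by exact_mod_cast (by omega)
        linarith)
    (fun m => by positivity)
  have e : ∑ m ∈ Finset.range j, (-1 : ℝ) ^ (M + m) * (1 / (((M + m : ℕ) : ℝ) + r))
      = (-1) ^ M * ∑ m ∈ Finset.range j, (-1 : ℝ) ^ m * (1 / (((M + m : ℕ) : ℝ) + r)) := by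
    rw [Finset.mul_sum]
    exact Finset.sum_congr rfl (fun k _ => by ring)
  rw [e]
  have hM' : (1 : ℝ) ≤ M := by exact_mod_cast hM
  have h3 : 1 / (((M + 0 : ℕ) : ℝ) + r) ≤ 1 / (M : ℝ) := by
    apply one_div_le_one_div_of_le
    · linarith
    · simp; linarith
  rcases neg_one_pow_eq_or ℝ M with h1 | h1 <;> rw [h1] <;> linarith [h.1, h.2]

lemma AA_sym (r : ℝ) (hr : 0 < r) (hr1 : r < 1) (M : ℕ) :
    4 * ∑ m ∈ Finset.range M, (-1 : ℝ) ^ m / (2 * m + 1) ≤ AA r M + AA (1 - r) M := by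
  have h := alt_bd M (fun m => (2 * r - 1) ^ 2 / ((2 * m + 1) * ((m + r) * (m + (1 - r)))))
    (fun i j hij => by
      have hij' : (i : ℝ) ≤ j := by exact_mod_cast hij
      have : 0 < 1 - r := by linarith
      dsimp only
      gcongr)
    (fun m => by
      have : 0 < 1 - r := by linarith
      positivity)
  have e : AA r M + AA (1 - r) M - 4 * ∑ m ∈ Finset.range M, (-1 : ℝ) ^ m / (2 * m + 1)
      = ∑ m ∈ Finset.range M, (-1 : ℝ) ^ m *
        ((2 * r - 1) ^ 2 / ((2 * m + 1) * ((m + r) * (m + (1 - r))))) := by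
    unfold AA
    rw [Finset.mul_sum, ← Finset.sum_add_distrib, ← Finset.sum_sub_distrib]
    refine Finset.sum_congr rfl (fun m _ => ?_)
    have h1 : (m : ℝ) + r ≠ 0 := by positivity
    have h2 : (m : ℝ) + (1 - r) ≠ 0 := by
      have : 0 < 1 - r := by linarith
      positivity
    have h3 : (2 * m + 1 : ℝ) ≠ 0 := by positivity
    field_simp
    ring
  linarith [h.1]

lemma split_sum (i q : ℕ) (r : ℝ) :
    ∑ k ∈ Finset.range (i + 1 + q), (-1 : ℝ) ^ k / ((i + r) - k)
      = (-1) ^ i * (AA r (i + 1) + AA (1 - r) q) := by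
  rw [Finset.sum_range_add, mul_add]
  congr 1
  · rw [← Finset.sum_range_reflect, AA, Finset.mul_sum]
    refine Finset.sum_congr rfl (fun m hm => ?_)
    have hm' : m ≤ i := by simpa [Nat.lt_succ_iff] using hm
    obtain ⟨j, rfl⟩ := Nat.exists_eq_add_of_le hm'
    have : m + j + 1 - 1 - m = j := by omega
    rw [this]
    have h2 : ((-1 : ℝ) ^ m) * (-1) ^ m = 1 := by rw [← mul_pow]; simp
    push_cast
    rw [show (m : ℝ) + j + r - j = m + r by ring, pow_add]
    linear_combination (-(-1 : ℝ) ^ j * (1 / (m + r))) * h2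
  · rw [AA, Finset.mul_sum]
    refine Finset.sum_congr rfl (fun m hm => ?_)
    push_cast
    rw [show (i : ℝ) + r - (i + 1 + m) = - (m + (1 - r)) by ring, pow_add, pow_add, div_neg]
    ring

lemma D_lower (x : ℝ) (hirr : Irrational x) (n M : ℕ) (hn : 0 < n)
    (hM : 1 ≤ M) (h1 : (M : ℝ) ≤ n * (x + 1) / 2) (h2 : (M : ℝ) ≤ n * (1 - x) / 2) :
    (n : ℝ) / 2 * (4 * (∑ m ∈ Finset.range M, (-1 : ℝ) ^ m / (2 * m + 1)) - 2 / M) ≤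
      |Dden n x| := by
  have hn' : (0 : ℝ) < n := by exact_mod_cast hn
  set y := (n : ℝ) * (x + 1) / 2 with hy
  have hy0 : 0 ≤ y := le_trans (by positivity) h1
  set i := ⌊y⌋₊ with hi
  have hi1 : (i : ℝ) ≤ y := Nat.floor_le hy0
  have hi2 : y < i + 1 := Nat.lt_floor_add_one y
  have hMi : M ≤ i := Nat.le_floor h1
  have hyn : y = n - n * (1 - x) / 2 := by rw [hy]; ring
  have hin : i + M ≤ n := by
    have : (i : ℝ) + M ≤ n := by linarith
    exact_mod_cast this
  have hne : y ≠ i := by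
    intro h
    apply hirr
    refine ⟨2 * i / n - 1, ?_⟩
    push_cast
    rw [← h, hy]
    field_simp
    ring
  set r := y - i with hr
  have hr0 : 0 < r := by
    have := lt_of_le_of_ne hi1 hne.symm
    linarith
  have hr1 : r < 1 := by linarith
  obtain ⟨q, hq⟩ := Nat.exists_eq_add_of_le hin
  have e : Dden n x = n / 2 * ((-1) ^ i * (AA r (i + 1) + AA (1 - r) (M + q))) := by
    rw [← split_sum, Dden, Finset.mul_sum]
    rw [show i + 1 + (M + q) = n + 1 by omega]
    refine Finset.sum_congr rfl (fun k _ => ?_)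
    rw [show x - node n k = 2 / n * (i + r - k) by
      rw [hr, node, hy]; field_simp; ring]
    rw [div_mul_eq_div_div, div_div_eq_mul_div]
    ring
  rw [e, abs_mul, abs_mul, abs_pow, abs_neg, abs_one, one_pow, one_mul,
    abs_of_pos (by positivity : (0 : ℝ) < n / 2)]
  apply mul_le_mul_of_nonneg_left _ (by positivity)
  refine le_trans ?_ (le_abs_self _)
  have a1 := AA_ge r hr0 M (i + 1) hM (by omega)
  have a2 := AA_ge (1 - r) (by linarith) M (M + q) hM (by omega)
  have a3 := AA_sym r hr0 hr1 M
  have : (2 : ℝ) / M = 1 / M + 1 / M := by ring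
  linarith

lemma alt_id (a : ℕ → ℝ) (N : ℕ) :
    2 * ∑ k ∈ Finset.range (N + 1), (-1 : ℝ) ^ k * a k
      = a 0 + (-1) ^ N * a N + ∑ k ∈ Finset.range N, (-1 : ℝ) ^ k * (a k - a (k + 1)) := by
  induction N with
  | zero => simp; ring
  | succ N ih =>
    rw [Finset.sum_range_succ, mul_add, ih, Finset.sum_range_succ _ N]
    ring

noncomputable def TT (G : ℝ → ℝ) (a c : ℝ) (n : ℕ) : ℝ :=
  ∑ k ∈ Finset.range n, (-1 : ℝ) ^ k *
    ∫ t in (a + (k : ℝ) * (c / n))..(a + ((k + 1 : ℕ) : ℝ) * (c / n)), G t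

lemma TT_bd (G : ℝ → ℝ) (hG : Integrable G) (a c : ℝ) (hc : 0 ≤ c) (n : ℕ) :
    |TT G a c n| ≤ ∫ t, |G t| := by
  have hd : 0 ≤ c / n := by positivity
  have hle : ∀ k : ℕ, a + (k : ℝ) * (c / n) ≤ a + ((k + 1 : ℕ) : ℝ) * (c / n) := by
    intro k
    push_cast
    nlinarith
  unfold TT
  refine (Finset.abs_sum_le_sum_abs _ _).trans ?_
  calc _ ≤ ∑ k ∈ Finset.range n,
        ∫ t in (a + (k : ℝ) * (c / n))..(a + ((k + 1 : ℕ) : ℝ) * (c / n)), |G t| := by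
        refine Finset.sum_le_sum (fun k _ => ?_)
        rw [abs_mul, abs_pow, abs_neg, abs_one, one_pow, one_mul]
        exact intervalIntegral.abs_integral_le_integral_abs (hle k)
    _ = ∫ t in (a + ((0 : ℕ) : ℝ) * (c / n))..(a + (n : ℝ) * (c / n)), |G t| :=
        intervalIntegral.sum_integral_adjacent_intervals
          (a := fun k : ℕ => a + (k : ℝ) * (c / n))
          (fun k _ => hG.abs.intervalIntegrable)
    _ ≤ ∫ t, |G t| := by
        rw [intervalIntegral.integral_of_le]
        · exact setIntegral_le_integral hG.abs (Eventually.of_forall fun t => abs_nonneg _)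
        · push_cast
          have : 0 ≤ (n : ℝ) * (c / n) := by positivity
          linarith

lemma TT_sub (G H : ℝ → ℝ) (hG : Integrable G) (hH : Integrable H) (a c : ℝ) (n : ℕ) :
    TT (fun t => G t - H t) a c n = TT G a c n - TT H a c n := by
  unfold TT
  rw [← Finset.sum_sub_distrib]
  refine Finset.sum_congr rfl (fun k _ => ?_)
  rw [intervalIntegral.integral_sub hG.intervalIntegrable hH.intervalIntegrable]
  ring

lemma TT_unif (H : ℝ → ℝ) (hH : Continuous H) (B : ℝ) (hB : ∀ t, |H t| ≤ B) (a c : ℝ)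
    (hc : 0 ≤ c) (N : ℕ) (ε : ℝ)
    (hε : ∀ t, |H t - H (t + c / ((N + 1 : ℕ) : ℝ))| ≤ ε) :
    2 * |TT H a c (N + 1)| ≤ 2 * (B * (c / ((N + 1 : ℕ) : ℝ))) + c * ε := by
  set d := c / ((N + 1 : ℕ) : ℝ) with hd
  have hd0 : 0 ≤ d := by positivity
  have hε0 : 0 ≤ ε := (abs_nonneg _).trans (hε 0)
  set I : ℕ → ℝ := fun k => ∫ t in (a + (k : ℝ) * d)..(a + ((k + 1 : ℕ) : ℝ) * d), H t with hI
  have eI : ∀ k, I k = ∫ t in (0 : ℝ)..d, H (t + (a + k * d)) := by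
    intro k
    rw [intervalIntegral.integral_comp_add_right]
    simp only [hI]
    congr 1
    · ring
    · push_cast; ring
  have hIb : ∀ k, |I k| ≤ B * d := by
    intro k
    rw [eI]
    have := intervalIntegral.norm_integral_le_of_norm_le_const (a := 0) (b := d) (C := B)
      (f := fun t => H (t + (a + k * d))) (fun t _ => hB _)
    rwa [sub_zero, abs_of_nonneg hd0] at this
  have hId : ∀ k, |I k - I (k + 1)| ≤ ε * d := by
    intro k
    rw [eI, eI, ← intervalIntegral.integral_sub]
    · have := intervalIntegral.norm_integral_le_of_norm_le_const (a := 0) (b := d) (C := ε)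
        (f := fun t => H (t + (a + k * d)) - H (t + (a + (k + 1 : ℕ) * d))) (fun t _ => by
          have := hε (t + (a + k * d))
          rw [Real.norm_eq_abs]
          convert this using 4
          push_cast; ring)
      rwa [sub_zero, abs_of_nonneg hd0] at this
    · exact (by fun_prop : Continuous _).intervalIntegrable _ _
    · exact (by fun_prop : Continuous _).intervalIntegrable _ _
  have e : 2 * TT H a c (N + 1) = _ := alt_id I N
  rw [← abs_two (α := ℝ), ← abs_mul, e, abs_two]
  have h3 : |∑ k ∈ Finset.range N, (-1 : ℝ) ^ k * (I k - I (k + 1))| ≤ c * ε := by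
    refine (Finset.abs_sum_le_sum_abs _ _).trans ?_
    calc _ ≤ ∑ k ∈ Finset.range N, ε * d := by
          refine Finset.sum_le_sum (fun k _ => ?_)
          rw [abs_mul, abs_pow, abs_neg, abs_one, one_pow, one_mul]
          exact hId k
      _ = (N * d) * ε := by simp; ring
      _ ≤ c * ε := by
          apply mul_le_mul_of_nonneg_right _ hε0
          have : ((N + 1 : ℕ) : ℝ) * d = c := by rw [hd]; field_simp
          push_cast at this
          linarith
  have h2 : |(-1 : ℝ) ^ N * I N| ≤ B * d := by
    rw [abs_mul, abs_pow, abs_neg, abs_one, one_pow, one_mul]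
    exact hIb N
  have := abs_add_three (I 0) ((-1 : ℝ) ^ N * I N)
    (∑ k ∈ Finset.range N, (-1 : ℝ) ^ k * (I k - I (k + 1)))
  linarith [hIb 0]

lemma TT_tendsto (G : ℝ → ℝ) (hG : Integrable G) (a c : ℝ) (hc : 0 ≤ c) :
    Tendsto (TT G a c) atTop (nhds 0) := by
  rw [Metric.tendsto_atTop]
  intro ε hε
  obtain ⟨H, hHs, hHe, hHc, hHi⟩ :=
    hG.exists_hasCompactSupport_integral_sub_le (show 0 < ε / 2 by linarith)
  obtain ⟨B, hB⟩ := hHs.exists_bound_of_continuous hHc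
  have hu := hHs.uniformContinuous_of_continuous hHc
  rw [Metric.uniformContinuous_iff] at hu
  obtain ⟨δ, hδ, hu⟩ := hu (ε / (2 * (c + 1))) (by positivity)
  have hB0 : 0 ≤ B := (norm_nonneg _).trans (hB 0)
  have hlim : Tendsto (fun N : ℕ => c / (N : ℝ)) atTop (nhds 0) :=
    tendsto_const_div_atTop_nhds_zero_nat c
  have ev := (hlim.eventually (gt_mem_nhds hδ)).and
    (hlim.eventually (gt_mem_nhds (show 0 < ε / (4 * (B + 1)) by positivity)))
  obtain ⟨N0, hN0⟩ := eventually_atTop.1 ev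
  refine ⟨N0 + 1, fun n hn => ?_⟩
  obtain ⟨N, rfl⟩ : ∃ N, n = N + 1 := ⟨n - 1, by omega⟩
  obtain ⟨h1, h2⟩ := hN0 (N + 1) (by omega)
  have hd0 : 0 ≤ c / ((N + 1 : ℕ) : ℝ) := by positivity
  have b1 := TT_unif H hHc B hB a c hc N (ε / (2 * (c + 1))) (fun t => by
    have := hu (a := t) (b := t + c / ((N + 1 : ℕ) : ℝ)) (by
      rw [Real.dist_eq, show t - (t + c / ((N + 1 : ℕ) : ℝ)) = -(c / ((N + 1 : ℕ) : ℝ)) by ring, abs_neg, abs_of_nonneg hd0]; exact h1)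
    rw [Real.dist_eq] at this
    exact this.le)
  have b2 := TT_bd (fun t => G t - H t) (hG.sub hHi) a c hc (N + 1)
  rw [TT_sub G H hG hHi] at b2
  have b3 : ∫ t, |G t - H t| ≤ ε / 2 := hHe
  have b4 : B * (c / ((N + 1 : ℕ) : ℝ)) ≤ ε / 4 := by
    calc _ ≤ B * (ε / (4 * (B + 1))) := by gcongr
      _ ≤ (B + 1) * (ε / (4 * (B + 1))) := by gcongr; linarith
      _ = ε / 4 := by field_simp
  have b5 : c * (ε / (2 * (c + 1))) < ε / 2 := by
    calc _ < (c + 1) * (ε / (2 * (c + 1))) := by gcongr; linarith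
      _ = ε / 2 := by field_simp
  rw [Real.dist_eq, sub_zero]
  have := abs_sub_abs_le_abs_sub (TT G a c (N + 1)) (TT H a c (N + 1))
  linarith

lemma node_mem (n k : ℕ) (hn : 0 < n) (hk : k ≤ n) : node n k ∈ Set.Icc (-1 : ℝ) 1 := by
  have hn' : (0 : ℝ) < n := by exact_mod_cast hn
  have hk' : (k : ℝ) ≤ n := by exact_mod_cast hk
  unfold node
  constructor
  · have : (0 : ℝ) ≤ 2 * k / n := by positivity
    linarith
  · have : (2 : ℝ) * k / n ≤ 2 := by rw [div_le_iff₀ hn']; linarith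
    linarith

lemma node_ne (x : ℝ) (hirr : Irrational x) (n k : ℕ) : x ≠ node n k := by
  intro h
  apply hirr
  refine ⟨2 * k / n - 1, ?_⟩
  push_cast
  rw [h, node]

noncomputable def phi (f : ℝ → ℝ) (x t : ℝ) : ℝ := (f t - f x) / (x - t)

lemma phi_eq (f F : ℝ → ℝ) (hF : Continuous F)
    (hd : ∀ u ∈ Set.Icc (-1 : ℝ) 1, HasDerivWithinAt f (F u) (Set.Icc (-1 : ℝ) 1) u)
    (x t : ℝ) (hx : x ∈ Set.Icc (-1 : ℝ) 1) (ht : t ∈ Set.Icc (-1 : ℝ) 1) (hne : x ≠ t) :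
    phi f x t = - ∫ s in (0 : ℝ)..1, F (x + (t - x) * s) := by
  have hsub : Set.uIcc x t ⊆ Set.Icc (-1) 1 := Set.uIcc_subset_Icc hx ht
  have h1 : ∫ u in x..t, F u = f t - f x := by
    apply intervalIntegral.integral_eq_sub_of_hasDeriv_right
    · intro u hu
      exact ((hd u (hsub hu)).continuousWithinAt).mono hsub
    · intro u hu
      have hu' : u ∈ Set.Ioo (-1 : ℝ) 1 := by
        have a1 : -1 ≤ min x t := le_min hx.1 ht.1
        have a2 : max x t ≤ 1 := max_le hx.2 ht.2
        exact ⟨lt_of_le_of_lt a1 hu.1, lt_of_lt_of_le hu.2 a2⟩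
      exact ((hd u ⟨hu'.1.le, hu'.2.le⟩).hasDerivAt (Icc_mem_nhds hu'.1 hu'.2)).hasDerivWithinAt
    · exact hF.intervalIntegrable _ _
  have h2 := intervalIntegral.mul_integral_comp_add_mul (a := 0) (b := 1) (f := F) (t - x) x
  simp only [mul_zero, add_zero, mul_one] at h2
  rw [show x + (t - x) = t by ring, h1] at h2
  have hne' : x - t ≠ 0 := sub_ne_zero.2 hne
  rw [phi, ← h2]
  field_simp
  ring

lemma num_tendsto (f : ℝ → ℝ) (hf : AC1 f) (x : ℝ) (hx : x ∈ Set.Ioo (-1 : ℝ) 1)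
    (hirr : Irrational x) :
    Tendsto (fun n : ℕ => ∑ k ∈ Finset.range n,
      (-1 : ℝ) ^ k * (phi f x (node n k) - phi f x (node n (k + 1)))) atTop (nhds 0) := by
  obtain ⟨f', hd, g, hg, hfg⟩ := hf
  set G := (Set.Ioc (-1 : ℝ) 1).indicator g with hGdef
  have hG : Integrable G := hg.1.integrable_indicator measurableSet_Ioc
  set F : ℝ → ℝ := fun u => f' (-1) + ∫ t in (-1 : ℝ)..u, G t with hFdef
  have hF : Continuous F := by
    have := intervalIntegral.continuous_primitive (μ := volume) (f := G)
      (fun a b => hG.intervalIntegrable) (-1)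
    exact continuous_const.add this
  have hFf : ∀ u ∈ Set.Icc (-1 : ℝ) 1, f' u = F u := by
    intro u hu
    rw [hfg u hu, hFdef]
    simp only
    congr 1
    rw [intervalIntegral.integral_of_le hu.1, intervalIntegral.integral_of_le hu.1]
    refine setIntegral_congr_fun measurableSet_Ioc (fun t ht => ?_)
    rw [hGdef, Set.indicator_of_mem]
    exact ⟨ht.1, ht.2.trans hu.2⟩
  have hd' : ∀ u ∈ Set.Icc (-1 : ℝ) 1, HasDerivWithinAt f (F u) (Set.Icc (-1 : ℝ) 1) u := by
    intro u hu
    rw [← hFf u hu]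
    exact hd u hu
  have hFs : ∀ u v, F v - F u = ∫ t in u..v, G t := by
    intro u v
    simp only [hFdef]
    rw [add_sub_add_left_eq_sub]
    exact intervalIntegral.integral_interval_sub_left hG.intervalIntegrable hG.intervalIntegrable
  have hTT : ∀ (n : ℕ) (s : ℝ), TT G (x - s * (1 + x)) (2 * s) n =
      ∑ k ∈ Finset.range n, (-1 : ℝ) ^ k *
        (F (x + (node n (k + 1) - x) * s) - F (x + (node n k - x) * s)) := by
    intro n s
    unfold TT
    refine Finset.sum_congr rfl (fun k _ => ?_)
    rw [hFs]
    congr 2 <;> (unfold node; ring)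
  have hcont : ∀ n, Continuous (fun s : ℝ => TT G (x - s * (1 + x)) (2 * s) n) := by
    intro n
    simp only [hTT]
    fun_prop
  have hx' : x ∈ Set.Icc (-1 : ℝ) 1 := ⟨hx.1.le, hx.2.le⟩
  have hE : ∀ n : ℕ, 0 < n → ∑ k ∈ Finset.range n,
      (-1 : ℝ) ^ k * (phi f x (node n k) - phi f x (node n (k + 1)))
      = ∫ s in (0 : ℝ)..1, TT G (x - s * (1 + x)) (2 * s) n := by
    intro n hn
    simp only [hTT]
    rw [intervalIntegral.integral_finsetSum]
    · refine Finset.sum_congr rfl (fun k hk => ?_)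
      have hk' := Finset.mem_range.1 hk
      rw [intervalIntegral.integral_const_mul, intervalIntegral.integral_sub,
        phi_eq f F hF hd' x _ hx' (node_mem n k hn (by omega)) (node_ne x hirr n k),
        phi_eq f F hF hd' x _ hx' (node_mem n (k + 1) hn (by omega)) (node_ne x hirr n (k + 1))]
      · ring
      · exact (by fun_prop : Continuous _).intervalIntegrable _ _
      · exact (by fun_prop : Continuous _).intervalIntegrable _ _
    · intro k _
      exact (by fun_prop : Continuous _).intervalIntegrable _ _
  have key : Tendsto (fun n : ℕ => ∫ s in (0 : ℝ)..1, TT G (x - s * (1 + x)) (2 * s) n) atTop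
      (nhds (∫ s in (0 : ℝ)..1, (0 : ℝ))) := by
    apply intervalIntegral.tendsto_integral_filter_of_dominated_convergence
      (fun _ => ∫ t, |G t|)
    · exact Eventually.of_forall fun n => (hcont n).aestronglyMeasurable
    · refine Eventually.of_forall fun n => Eventually.of_forall fun s hs => ?_
      rw [Set.uIoc_of_le zero_le_one] at hs
      exact TT_bd G hG _ _ (by linarith [hs.1]) n
    · exact intervalIntegrable_const
    · refine Eventually.of_forall fun s hs => ?_
      rw [Set.uIoc_of_le zero_le_one] at hs
      exact TT_tendsto G hG _ _ (by linarith [hs.1])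
  rw [intervalIntegral.integral_zero] at key
  refine key.congr' ?_
  filter_upwards [eventually_gt_atTop 0] with n hn
  exact (hE n hn).symm

lemma S_eq (f : ℝ → ℝ) (x : ℝ) (n : ℕ) (hirr : Irrational x) (hn : 0 < n) (ho : Odd n) :
    Nnum f n x - f x * Dden n x = Ofun f x + (∑ k ∈ Finset.range n,
      (-1 : ℝ) ^ k * (phi f x (node n k) - phi f x (node n (k + 1)))) / 2 := by
  have hn' : (n : ℝ) ≠ 0 := by positivity
  have h := alt_id (fun k => phi f x (node n k)) n
  have e : Nnum f n x - f x * Dden n x =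
      ∑ k ∈ Finset.range (n + 1), (-1 : ℝ) ^ k * phi f x (node n k) := by
    unfold Nnum Dden phi
    rw [Finset.mul_sum, ← Finset.sum_sub_distrib]
    exact Finset.sum_congr rfl (fun k _ => by ring)
  have n0 : node n 0 = -1 := by simp [node]
  have nn : node n n = 1 := by unfold node; field_simp; norm_num
  have hO : phi f x (-1) + -1 * phi f x 1 = 2 * Ofun f x := by
    have h1 : x - 1 ≠ 0 := sub_ne_zero.2 (by simpa using hirr.ne_one)
    have h2 : x + 1 ≠ 0 := by
      intro h
      apply hirr
      exact ⟨-1, by push_cast; linarith⟩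
    unfold phi Ofun
    rw [sub_neg_eq_add]
    field_simp
    ring
  rw [e]
  simp only [n0, nn, ho.neg_one_pow] at h
  linarith

lemma main_bd (f : ℝ → ℝ) (x : ℝ) (hirr : Irrational x) (n M : ℕ) (hn : 0 < n)
    (hM : 1 ≤ M) (h1 : (M : ℝ) ≤ n * (x + 1) / 2) (h2 : (M : ℝ) ≤ n * (1 - x) / 2)
    (hpos : 0 < 4 * (∑ m ∈ Finset.range M, (-1 : ℝ) ^ m / (2 * m + 1)) - 2 / M) :
    |(n : ℝ) * (berrut f n x - f x)| ≤ 2 * |Nnum f n x - f x * Dden n x| /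
      (4 * (∑ m ∈ Finset.range M, (-1 : ℝ) ^ m / (2 * m + 1)) - 2 / M) := by
  have hn' : (0 : ℝ) < n := by exact_mod_cast hn
  have hD := D_lower x hirr n M hn hM h1 h2
  set c := 4 * (∑ m ∈ Finset.range M, (-1 : ℝ) ^ m / (2 * m + 1)) - 2 / M with hc
  have hDp : 0 < |Dden n x| := lt_of_lt_of_le (by positivity) hD
  have hD0 : Dden n x ≠ 0 := abs_pos.1 hDp
  have hb : berrut f n x = Nnum f n x / Dden n x := by
    unfold berrut
    rw [if_neg]
    rintro ⟨k, _, hk⟩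
    exact node_ne x hirr n k hk
  have e : (n : ℝ) * (berrut f n x - f x) = n * (Nnum f n x - f x * Dden n x) / Dden n x := by
    rw [hb]; field_simp
  rw [e, abs_div, abs_mul, abs_of_pos hn', div_le_div_iff₀ hDp hpos]
  have := mul_le_mul_of_nonneg_left hD (abs_nonneg (Nnum f n x - f x * Dden n x))
  linarith

/-- for `f ∈ AC¹`, irrational `x ∈ (-1,1)` and an odd sequence along which
`n_j (B_{n_j}(f,x) - f(x))` converges in `ℝ ∪ {±∞}`, the limit `L` is finite and
`|L| ≤ 2|O(f,x)|/π`. -/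
theorem statement3 (f : ℝ → ℝ) (hf : AC1 f) (x : ℝ) (hx : x ∈ Set.Ioo (-1 : ℝ) 1)
    (hirr : Irrational x) (n : ℕ → ℕ) (hmono : StrictMono n)
    (hodd : ∀ j, Odd (n j) ∧ 0 < n j) (L : EReal)
    (hlim : Filter.Tendsto
      (fun j : ℕ => (((n j : ℝ) * (berrut f (n j) x - f x) : ℝ) : EReal))
      Filter.atTop (nhds L)) :
    ∃ l : ℝ, L = (l : EReal) ∧ |l| ≤ 2 * |Ofun f x| / Real.pi := by
  have hn : Tendsto n atTop atTop := hmono.tendsto_atTop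
  have hnR : Tendsto (fun j => (n j : ℝ)) atTop atTop := tendsto_natCast_atTop_atTop.comp hn
  set κ := min ((x + 1) / 2) ((1 - x) / 2) with hκ
  have hκ0 : 0 < κ := lt_min (by linarith [hx.1]) (by linarith [hx.2])
  set M : ℕ → ℕ := fun j => ⌊(n j : ℝ) * κ⌋₊ with hMdef
  have hM : Tendsto M atTop atTop :=
    tendsto_nat_floor_atTop.comp (hnR.atTop_mul_const hκ0)
  set c : ℕ → ℝ := fun j =>
    4 * (∑ m ∈ Finset.range (M j), (-1 : ℝ) ^ m / (2 * m + 1)) - 2 / (M j : ℝ) with hcdef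
  have hc : Tendsto c atTop (nhds Real.pi) := by
    have h1 := (Real.tendsto_sum_pi_div_four.const_mul 4).sub
      (tendsto_const_div_atTop_nhds_zero_nat (2 : ℝ))
    have h2 := h1.comp hM
    rw [show 4 * (Real.pi / 4) - 0 = Real.pi by ring] at h2
    exact h2
  have hS : Tendsto (fun j => Nnum f (n j) x - f x * Dden (n j) x) atTop (nhds (Ofun f x)) := by
    have h1 := (((num_tendsto f hf x hx hirr).comp hn).div_const 2).const_add (Ofun f x)
    rw [zero_div, add_zero] at h1
    refine h1.congr (fun j => ?_)
    exact (S_eq f x (n j) hirr (hodd j).2 (hodd j).1).symm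
  have hb : Tendsto (fun j => 2 * |Nnum f (n j) x - f x * Dden (n j) x| / c j) atTop
      (nhds (2 * |Ofun f x| / Real.pi)) :=
    (hS.abs.const_mul 2).div hc Real.pi_ne_zero
  have hev : ∀ᶠ j in atTop, |(n j : ℝ) * (berrut f (n j) x - f x)| ≤
      2 * |Nnum f (n j) x - f x * Dden (n j) x| / c j := by
    filter_upwards [hM.eventually_ge_atTop 1, hc.eventually (lt_mem_nhds Real.pi_pos)]
      with j hj1 hj2
    have hfl : (M j : ℝ) ≤ n j * κ := Nat.floor_le (by positivity)
    have k1 : (n j : ℝ) * κ ≤ n j * ((x + 1) / 2) := by gcongr; exact min_le_left _ _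
    have k2 : (n j : ℝ) * κ ≤ n j * ((1 - x) / 2) := by gcongr; exact min_le_right _ _
    exact main_bd f x hirr (n j) (M j) (hodd j).2 hj1 (by linarith) (by linarith) hj2
  have hup : L ≤ ((2 * |Ofun f x| / Real.pi : ℝ) : EReal) := by
    refine le_of_tendsto_of_tendsto hlim ((continuous_coe_real_ereal.tendsto _).comp hb) ?_
    filter_upwards [hev] with j hj
    exact EReal.coe_le_coe_iff.2 ((le_abs_self _).trans hj)
  have hlo : ((-(2 * |Ofun f x| / Real.pi) : ℝ) : EReal) ≤ L := by
    refine le_of_tendsto_of_tendsto ((continuous_coe_real_ereal.tendsto _).comp hb.neg) hlim ?_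
    filter_upwards [hev] with j hj
    exact EReal.coe_le_coe_iff.2 (neg_le_of_abs_le hj)
  induction L using EReal.rec with
  | bot => exact absurd hlo (by simp)
  | top => exact absurd hup (by simp)
  | coe l =>
    refine ⟨l, rfl, abs_le.2 ⟨?_, ?_⟩⟩
    · exact EReal.coe_le_coe_iff.1 hlo
    · exact EReal.coe_le_coe_iff.1 hup
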